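/- Let α > 0 and let U ⊆ (0,1)^m be open. Let b : U → ℝ^n be a bounded-monomial map (each component is either identically zero or of the form x^{μ^{(i)}} with bounded image on U) such that all first-order partial derivatives of all component functions of b are bounded on U. Let F be a function that is analytic and non-vanishing on an open neighborhood of the topological closure of the image of b, let b_j be a component function of b, and define the analytic-bounded-monomial function f : U → ℝ by f(x) = b_j(x) · F(b(x)). Let P : (0,1)^m → (0,1)^m be given by P(x_1,…,x_m) = (P_α(x_1),…,P_α(x_m)) where P_α(x) = exp(1 - x^{-α}). Then f ∘ P : P^{-1}(U) → ℝ is 1/α-mild; i.e., there exist A, B > 0 such that for every x ∈ P^{-1}(U) and every multi-index ν ∈ ℕ^m, |(f ∘ P)^{(ν)}(x)| ≤ B A^{|ν|} (|ν|!)^{1/α + 1}. -/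

import Mathlib

open Real Set

/-- The partial derivative `∂f/∂xᵢ`. -/
noncomputable def pDeriv {m : ℕ} (i : Fin m) (f : (Fin m → ℝ) → ℝ) : (Fin m → ℝ) → ℝ :=
  fun x => fderiv ℝ f x (Pi.single i 1)

/-- The iterated partial derivative `f⁽ᵛ⁾ = ∂^|ν| f / ∂x₁^ν₁ ⋯ ∂x_m^ν_m`. -/
noncomputable def mDeriv {m : ℕ} (ν : Fin m → ℕ) (f : (Fin m → ℝ) → ℝ) : (Fin m → ℝ) → ℝ :=
  (List.finRange m).foldr (fun i g => (pDeriv i)^[ν i] g) f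

/-- A function `f` is `(A,B,C)`-mild on an open set `U ⊆ (0,1)^m`:
`f` is `C^∞` on `U` and `|f⁽ᵛ⁾(x)| ≤ B A^|ν| (|ν|!)^(C+1)` for all `x ∈ U`
and multi-indices `ν ∈ ℕ^m`. -/
def IsMildM {m : ℕ} (U : Set (Fin m → ℝ)) (f : (Fin m → ℝ) → ℝ) (A B C : ℝ) : Prop :=
  ContDiffOn ℝ (⊤ : ℕ∞) f U ∧
    ∀ x ∈ U, ∀ ν : Fin m → ℕ,
      |mDeriv ν f x| ≤ B * A ^ (∑ i, ν i) * ((∑ i, ν i).factorial : ℝ) ^ (C + 1)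


/-! ### Weighted directional derivatives along words -/

/-- Weighted partial derivative. -/
noncomputable def sD {m : ℕ} (ρ : Fin m → ℝ) (i : Fin m) (f : (Fin m → ℝ) → ℝ) :
    (Fin m → ℝ) → ℝ := fun y => ρ i * pDeriv i f y

/-- Iterated weighted partial derivative along a word (innermost letter first). -/
noncomputable def wD {m : ℕ} (ρ : Fin m → ℝ) : List (Fin m) → ((Fin m → ℝ) → ℝ) →
    ((Fin m → ℝ) → ℝ)
  | [], f => f
  | i :: w, f => wD ρ w (sD ρ i f)

/-- Smoothness on a set. -/
def Sm {m : ℕ} (V : Set (Fin m → ℝ)) (f : (Fin m → ℝ) → ℝ) : Prop :=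
  ContDiffOn ℝ (⊤ : ℕ∞) f V

section words
variable {m : ℕ} {V : Set (Fin m → ℝ)} {ρ : Fin m → ℝ} {f g : (Fin m → ℝ) → ℝ}

lemma Sm.diffAt (hV : IsOpen V) (hf : Sm V f) {x} (hx : x ∈ V) : DifferentiableAt ℝ f x :=
  (hf.contDiffAt (hV.mem_nhds hx)).differentiableAt (by simp)

lemma pDeriv_congr (hV : IsOpen V) (i : Fin m) (h : EqOn f g V) :
    EqOn (pDeriv i f) (pDeriv i g) V := by
  intro x hx
  have : f =ᶠ[nhds x] g := Filter.eventuallyEq_of_mem (hV.mem_nhds hx) h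
  simp only [pDeriv, this.fderiv_eq]

lemma Sm.pDeriv (hV : IsOpen V) (i : Fin m) (hf : Sm V f) : Sm V (pDeriv i f) := by
  have h : ContDiffOn ℝ (⊤ : ℕ∞) (fderiv ℝ f) V := hf.fderiv_of_isOpen hV (by simp)
  exact h.clm_apply contDiffOn_const

lemma Sm.congr (hf : Sm V f) (h : EqOn g f V) : Sm V g := ContDiffOn.congr hf h

lemma Sm.sD (hV : IsOpen V) (i : Fin m) (hf : Sm V f) : Sm V (sD ρ i f) :=
  contDiffOn_const.mul (hf.pDeriv hV i)

lemma Sm.mul (hf : Sm V f) (hg : Sm V g) : Sm V (fun y => f y * g y) := ContDiffOn.mul hf hg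

lemma Sm.add (hf : Sm V f) (hg : Sm V g) : Sm V (fun y => f y + g y) := ContDiffOn.add hf hg

lemma Sm.sum {ι : Type*} {s : Finset ι} {F : ι → (Fin m → ℝ) → ℝ} (hf : ∀ k ∈ s, Sm V (F k)) :
    Sm V (fun y => ∑ k ∈ s, F k y) := ContDiffOn.sum hf

lemma sD_congr (hV : IsOpen V) (i : Fin m) (h : EqOn f g V) :
    EqOn (sD ρ i f) (sD ρ i g) V := by
  intro x hx
  simp only [sD, pDeriv_congr hV i h hx]

lemma wD_congr (hV : IsOpen V) (w : List (Fin m)) (h : EqOn f g V) :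
    EqOn (wD ρ w f) (wD ρ w g) V := by
  induction w generalizing f g with
  | nil => exact h
  | cons i w ih => exact ih (sD_congr hV i h)

lemma sD_zero (i : Fin m) : sD ρ i (fun _ => 0) = fun _ => 0 := by
  funext y; simp [sD, pDeriv]

lemma wD_zero (w : List (Fin m)) : wD ρ w (fun _ => 0) = fun _ => 0 := by
  induction w with
  | nil => rfl
  | cons i w ih => rw [wD, sD_zero, ih]

lemma sD_add (hV : IsOpen V) (i : Fin m) (hf : Sm V f) (hg : Sm V g) :
    EqOn (sD ρ i (fun y => f y + g y)) (fun y => sD ρ i f y + sD ρ i g y) V := by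
  intro x hx
  simp only [sD, pDeriv, fderiv_fun_add (hf.diffAt hV hx) (hg.diffAt hV hx), _root_.add_apply]
  ring

lemma sD_mul (hV : IsOpen V) (i : Fin m) (hf : Sm V f) (hg : Sm V g) :
    EqOn (sD ρ i (fun y => f y * g y)) (fun y => f y * sD ρ i g y + sD ρ i f y * g y) V := by
  intro x hx
  simp only [sD, pDeriv, fderiv_fun_mul (hf.diffAt hV hx) (hg.diffAt hV hx), _root_.add_apply,
    _root_.smul_apply, smul_eq_mul]
  ring

lemma wD_add (hV : IsOpen V) (w : List (Fin m)) (hf : Sm V f) (hg : Sm V g) :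
    EqOn (wD ρ w (fun y => f y + g y)) (fun y => wD ρ w f y + wD ρ w g y) V := by
  induction w generalizing f g with
  | nil => intro x _; rfl
  | cons i w ih =>
    intro x hx
    simp only [wD]
    rw [wD_congr hV w (sD_add hV i hf hg) hx, ih (hf.sD hV i) (hg.sD hV i) hx]

lemma wD_sum (hV : IsOpen V) (w : List (Fin m)) {ι : Type*} (s : Finset ι)
    {F : ι → (Fin m → ℝ) → ℝ} (hf : ∀ k ∈ s, Sm V (F k)) :
    EqOn (wD ρ w (fun y => ∑ k ∈ s, F k y)) (fun y => ∑ k ∈ s, wD ρ w (F k) y) V := by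
  classical
  induction s using Finset.induction_on with
  | empty => intro x _; simp [wD_zero]
  | insert a s ha ih =>
    intro x hx
    simp only [Finset.sum_insert ha]
    rw [wD_add hV w (hf a (by simp)) (Sm.sum fun k hk => hf k (by simp [hk])) hx]
    simp only
    rw [ih (fun k hk => hf k (by simp [hk])) hx]

/-- Leibniz bound. -/
lemma leibniz (hV : IsOpen V) {x : Fin m → ℝ} (hx : x ∈ V) (n : ℕ) :
    ∀ (f g : (Fin m → ℝ) → ℝ) (a a' : ℕ → ℝ), Sm V f → Sm V g →
    (∀ w : List (Fin m), w.length ≤ n → |wD ρ w f x| ≤ a w.length) →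
    (∀ w : List (Fin m), w.length ≤ n → |wD ρ w g x| ≤ a' w.length) →
    ∀ w : List (Fin m), w.length = n →
    |wD ρ w (fun y => f y * g y) x| ≤
      ∑ j ∈ Finset.range (n + 1), (n.choose j : ℝ) * (a j * a' (n - j)) := by
  induction n with
  | zero =>
    intro f g a a' hf hg ha ha' w hw
    obtain rfl := List.length_eq_zero_iff.mp hw
    have h1 := ha [] (by simp)
    have h2 := ha' [] (by simp)
    simp only [wD, List.length_nil] at h1 h2
    simp only [wD, abs_mul]
    simpa using mul_le_mul h1 h2 (abs_nonneg _) ((abs_nonneg _).trans h1)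
  | succ n ih =>
    intro f g a a' hf hg ha ha' w hw
    obtain ⟨i, w, rfl⟩ := List.exists_cons_of_length_eq_add_one hw
    simp only [List.length_cons, Nat.add_right_cancel_iff] at hw
    simp only [wD]
    rw [wD_congr hV w (sD_mul hV i hf hg) hx,
      wD_add hV w (hf.mul (hg.sD hV i)) ((hf.sD hV i).mul hg) hx]
    refine (abs_add_le _ _).trans ?_
    rw [Finset.sum_choose_succ_mul (fun p q => a p * a' q)]
    refine add_le_add ?_ ?_
    · have := ih f (sD ρ i g) a (fun k => a' (k + 1)) hf (hg.sD hV i)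
        (fun w hw => ha w (by omega)) (fun w hw => ha' (i :: w) (by simpa using hw)) w hw
      refine this.trans (le_of_eq (Finset.sum_congr rfl fun j hj => ?_))
      have : n + 1 - j = n - j + 1 := by have := Finset.mem_range.mp hj; omega
      rw [this]
    · exact ih (sD ρ i f) g (fun k => a (k + 1)) a' (hf.sD hV i) hg
        (fun w hw => ha (i :: w) (by simpa using hw)) (fun w hw => ha' w (by omega)) w hw

end words

lemma geom_aux {B Q : ℝ} (hB : 0 ≤ B) (hQ : 0 ≤ Q) (n : ℕ) :
    (1 + Q) * ∑ j ∈ Finset.range (n + 1), (2 * B * (1 + Q)) ^ j * B ^ (n - j + 1) ≤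
      (2 * B * (1 + Q)) ^ (n + 1) := by
  set A := 2 * B * (1 + Q) with hA
  have hA0 : 0 ≤ A := by positivity
  induction n with
  | zero => simp; nlinarith [mul_nonneg hB hQ]
  | succ n ih =>
    rw [Finset.sum_range_succ]
    have : ∑ j ∈ Finset.range (n + 1), A ^ j * B ^ (n + 1 - j + 1) =
        B * ∑ j ∈ Finset.range (n + 1), A ^ j * B ^ (n - j + 1) := by
      rw [Finset.mul_sum]
      refine Finset.sum_congr rfl fun j hj => ?_
      have : n + 1 - j = n - j + 1 := by have := Finset.mem_range.mp hj; omega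
      rw [this]; ring
    rw [this]
    have e : n + 1 - (n + 1) + 1 = 1 := by omega
    rw [e, pow_one]
    have h1 := mul_le_mul_of_nonneg_left ih hB
    have h2 : A ^ (n + 1 + 1) = A ^ (n+1) * B * (1 + Q) + A ^ (n+1) * B * (1+Q) := by
      rw [pow_succ, hA]; ring
    have h3 : 0 ≤ A ^ (n+1) * B * Q := by positivity
    rw [h2]
    nlinarith

lemma fact_aux (n j q : ℕ) (hj : j ≤ n) :
    (n.choose j : ℝ) * ((j + q).factorial * (n - j).factorial) ≤ ((n + q).factorial : ℝ) := by
  have key : n.choose j * ((j + q).factorial * (n - j).factorial) ≤ (n + q).factorial := by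
    have h1 : n.choose j ≤ (n + q).choose (j + q) := by
      rw [← Nat.choose_symm hj, ← Nat.choose_symm (by omega : j + q ≤ n + q)]
      have : n + q - (j + q) = n - j := by omega
      rw [this]
      exact Nat.choose_le_choose _ (by omega)
    have h2 := Nat.choose_mul_factorial_mul_factorial (by omega : j + q ≤ n + q)
    have : n + q - (j + q) = n - j := by omega
    rw [this] at h2
    rw [← h2, ← mul_assoc]
    gcongr
  exact_mod_cast key

section comp
variable {m N : ℕ} {V : Set (Fin m → ℝ)} {ρ : Fin m → ℝ}
  {H : List (Fin N) → (Fin m → ℝ) → ℝ} {c : Fin N → (Fin m → ℝ) → ℝ}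
  {x : Fin m → ℝ} {C R M K A M' : ℝ}

lemma comp_step (hV : IsOpen V) (hx : x ∈ V)
    (hHs : ∀ β, Sm V (H β)) (hcs : ∀ k, Sm V (c k))
    (hH : ∀ β i, EqOn (sD ρ i (H β)) (fun y => ∑ k, H (k :: β) y * sD ρ i (c k) y) V)
    (hC : 0 ≤ C) (hR : 0 ≤ R) (hM : 0 ≤ M) (hM' : 0 ≤ M') (hK : 0 ≤ K)
    (hA : A = 4 * K * (1 + R * N * M))
    (n : ℕ) (β : List (Fin N)) (i : Fin m)
    (hb : ∀ k, ∀ w : List (Fin m), w.length ≤ n → |wD ρ w (H (k :: β)) x| ≤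
      C * R ^ (β.length + 1) * A ^ w.length * (w.length + (β.length + 1)).factorial)
    (hc : ∀ k, ∀ w : List (Fin m), |wD ρ w (sD ρ i (c k)) x| ≤
      M' * K ^ (w.length + 1) * (w.length + 1).factorial)
    (w : List (Fin m)) (hw : w.length = n) :
    (1 + R * N * M) * |wD ρ w (sD ρ i (H β)) x| ≤
      (R * N * M') * (C * R ^ β.length * A ^ (n + 1) * (n + 1 + β.length).factorial) := by
  set q := β.length with hq
  have hA0 : 0 ≤ A := by rw [hA]; positivity
  rw [wD_congr hV w (hH β i) hx,
    wD_sum hV w _ (fun k _ => (hHs (k :: β)).mul ((hcs k).sD hV i)) hx]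
  have h1 : ∀ k, |wD ρ w (fun y => H (k :: β) y * sD ρ i (c k) y) x| ≤
      (C * R ^ (q + 1) * M' * (n + 1 + q).factorial) *
        ∑ j ∈ Finset.range (n + 1), A ^ j * (2 * K) ^ (n - j + 1) := by
    intro k
    refine (leibniz hV hx n (H (k :: β)) (sD ρ i (c k)) 
      (fun l => C * R ^ (q + 1) * A ^ l * (l + (q + 1)).factorial)
      (fun l => M' * K ^ (l + 1) * (l + 1).factorial) (hHs _) ((hcs k).sD hV i)
      (hb k) (fun w _ => hc k w) w hw).trans ?_
    rw [Finset.mul_sum]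
    refine Finset.sum_le_sum fun j hj => ?_
    have hj : j ≤ n := by have := Finset.mem_range.mp hj; omega
    have f1 := fact_aux n j (q + 1) hj
    have f2 : ((n - j + 1 : ℕ) : ℝ) ≤ 2 ^ (n - j + 1) := by
      exact_mod_cast Nat.lt_two_pow_self.le
    have e1 : (n + (q + 1)).factorial = (n + 1 + q).factorial := by congr 1; ring
    rw [e1] at f1
    calc (n.choose j : ℝ) * (C * R ^ (q + 1) * A ^ j * (j + (q + 1)).factorial *
          (M' * K ^ (n - j + 1) * (n - j + 1).factorial))
        = (C * R ^ (q + 1) * M' * A ^ j * K ^ (n - j + 1)) *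
          ((n.choose j : ℝ) * ((j + (q + 1)).factorial * (n - j).factorial)) *
            ((n - j + 1 : ℕ) : ℝ) := by
          rw [Nat.factorial_succ (n - j)]; push_cast; ring
      _ ≤ (C * R ^ (q + 1) * M' * A ^ j * K ^ (n - j + 1)) *
          ((n + 1 + q).factorial : ℝ) * 2 ^ (n - j + 1) := by gcongr
      _ = _ := by rw [mul_pow]; ring
  have h2 := geom_aux (B := 2 * K) (Q := R * N * M) (by positivity) (by positivity) n
  have e2 : 2 * (2 * K) * (1 + R * N * M) = A := by rw [hA]; ring
  rw [e2] at h2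
  set S := ∑ j ∈ Finset.range (n + 1), A ^ j * (2 * K) ^ (n - j + 1)
  have h3 : |∑ k, wD ρ w (fun y => H (k :: β) y * sD ρ i (c k) y) x| ≤
      N * ((C * R ^ (q + 1) * M' * (n + 1 + q).factorial) * S) := by
    refine (Finset.abs_sum_le_sum_abs _ _).trans ?_
    refine (Finset.sum_le_sum fun k _ => h1 k).trans ?_
    simp
  calc (1 + R * N * M) * |∑ k, wD ρ w (fun y => H (k :: β) y * sD ρ i (c k) y) x|
      ≤ (1 + R * N * M) * (N * ((C * R ^ (q + 1) * M' * (n + 1 + q).factorial) * S)) := by gcongr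
    _ = (N * (C * R ^ (q + 1) * M' * (n + 1 + q).factorial)) * ((1 + R * N * M) * S) := by ring
    _ ≤ (N * (C * R ^ (q + 1) * M' * (n + 1 + q).factorial)) * A ^ (n + 1) := by gcongr
    _ = _ := by ring

lemma comp_bound (hV : IsOpen V) (hx : x ∈ V)
    (hHs : ∀ β, Sm V (H β)) (hcs : ∀ k, Sm V (c k))
    (hH : ∀ β i, EqOn (sD ρ i (H β)) (fun y => ∑ k, H (k :: β) y * sD ρ i (c k) y) V)
    (hC : 0 ≤ C) (hR : 0 ≤ R) (hM : 0 ≤ M) (hK : 0 ≤ K)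
    (hA : A = 4 * K * (1 + R * N * M))
    (hb : ∀ β, |H β x| ≤ C * R ^ β.length * β.length.factorial)
    (hc : ∀ k i, ∀ w : List (Fin m), |wD ρ w (sD ρ i (c k)) x| ≤
      M * K ^ (w.length + 1) * (w.length + 1).factorial) (n : ℕ) :
    ∀ w : List (Fin m), w.length ≤ n → ∀ β, |wD ρ w (H β) x| ≤
      C * R ^ β.length * A ^ w.length * (w.length + β.length).factorial := by
  induction n with
  | zero =>
    intro w hw β
    obtain rfl := List.length_eq_zero_iff.mp (Nat.le_zero.mp hw)
    simpa [wD] using hb β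
  | succ n ih =>
    intro w hw β
    rcases w with _ | ⟨i, w⟩
    · simpa [wD] using hb β
    simp only [List.length_cons, Nat.add_le_add_iff_right] at hw
    have hA0 : 0 ≤ A := by rw [hA]; positivity
    have := comp_step hV hx hHs hcs hH hC hR hM hM hK hA w.length β i
      (fun k w' hw' => by simpa using ih w' (hw'.trans hw) (k :: β)) (fun k w => hc k i w) w rfl
    simp only [wD, List.length_cons]
    set X := C * R ^ β.length * A ^ (w.length + 1) * (w.length + 1 + β.length).factorial
    have hX : 0 ≤ X := by positivity
    have hQ : 0 ≤ R * N * M := by positivity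
    refine le_of_mul_le_mul_left (this.trans ?_) (by linarith : 0 < 1 + R * N * M)
    nlinarith

/-- Bound with a refined constant for a fixed first letter. -/
lemma comp_bound' (hV : IsOpen V) (hx : x ∈ V)
    (hHs : ∀ β, Sm V (H β)) (hcs : ∀ k, Sm V (c k))
    (hH : ∀ β i, EqOn (sD ρ i (H β)) (fun y => ∑ k, H (k :: β) y * sD ρ i (c k) y) V)
    (hC : 0 ≤ C) (hR : 0 ≤ R) (hM : 0 ≤ M) (hM' : 0 ≤ M') (hK : 0 ≤ K)
    (hA : A = 4 * K * (1 + R * N * M))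
    (hb : ∀ β, |H β x| ≤ C * R ^ β.length * β.length.factorial)
    (hc : ∀ k i, ∀ w : List (Fin m), |wD ρ w (sD ρ i (c k)) x| ≤
      M * K ^ (w.length + 1) * (w.length + 1).factorial) (i : Fin m)
    (hc' : ∀ k, ∀ w : List (Fin m), |wD ρ w (sD ρ i (c k)) x| ≤
      M' * K ^ (w.length + 1) * (w.length + 1).factorial) (w : List (Fin m)) :
    |wD ρ w (sD ρ i (H [])) x| ≤
      (R * N * M') * (C * A ^ (w.length + 1) * (w.length + 1).factorial) := by
  have := comp_step hV hx hHs hcs hH hC hR hM hM' hK hA w.length [] i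
      (fun k w' hw' => by
        simpa using comp_bound hV hx hHs hcs hH hC hR hM hK hA hb hc _ w' le_rfl [k])
      hc' w rfl
  simp only [List.length_nil, pow_zero, mul_one, add_zero] at this
  refine le_trans ?_ this
  have hQ : 0 ≤ R * N * M := by positivity
  nlinarith [abs_nonneg (wD ρ w (sD ρ i (H [])) x)]

end comp

section perm
variable {m : ℕ} {V : Set (Fin m → ℝ)} {ρ : Fin m → ℝ} {f g : (Fin m → ℝ) → ℝ}

lemma pDeriv_const_mul (i : Fin m) (c : ℝ) (f : (Fin m → ℝ) → ℝ) :
    pDeriv i (fun y => c * f y) = fun y => c * pDeriv i f y := by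
  funext y
  have h : (fun y => c * f y) = c • f := rfl
  simp only [pDeriv, h, fderiv_const_smul_field]
  simp

lemma two_le_smooth : (2 : WithTop ℕ∞) ≤ ((⊤ : ℕ∞) : WithTop ℕ∞) :=
  WithTop.coe_le_coe.2 (le_top : (2 : ℕ∞) ≤ ⊤)

lemma pDeriv_comm (hV : IsOpen V) (hf : Sm V f) (i j : Fin m) :
    EqOn (pDeriv i (pDeriv j f)) (pDeriv j (pDeriv i f)) V := by
  intro x hx
  have hc : ContDiffAt ℝ (⊤ : ℕ∞) f x := hf.contDiffAt (hV.mem_nhds hx)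
  have hd : DifferentiableAt ℝ (fderiv ℝ f) x :=
    (hc.fderiv_right (m := 1) (by simpa [one_add_one_eq_two] using two_le_smooth)).differentiableAt
      (by simp)
  have hs : IsSymmSndFDerivAt ℝ f x := hc.isSymmSndFDerivAt (by
    rw [minSmoothness_of_isRCLikeNormedField]; exact two_le_smooth)
  have key : ∀ v w : Fin m → ℝ, fderiv ℝ (fun y => fderiv ℝ f y v) x w =
      fderiv ℝ (fderiv ℝ f) x w v := by
    intro v w
    rw [fderiv_clm_apply hd (by fun_prop)]
    simp
  change fderiv ℝ (fun y => fderiv ℝ f y _) x _ = fderiv ℝ (fun y => fderiv ℝ f y _) x _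
  rw [key, key]
  exact hs _ _

lemma sD_comm (hV : IsOpen V) (hf : Sm V f) (i j : Fin m) :
    EqOn (sD ρ i (sD ρ j f)) (sD ρ j (sD ρ i f)) V := by
  intro x hx
  have := pDeriv_comm hV hf i j hx
  change ρ i * pDeriv i (fun y => ρ j * pDeriv j f y) x =
    ρ j * pDeriv j (fun y => ρ i * pDeriv i f y) x
  rw [pDeriv_const_mul, pDeriv_const_mul]
  simp only
  rw [this]
  ring

lemma wD_perm (hV : IsOpen V) {w w' : List (Fin m)} (h : w.Perm w') :
    ∀ {f}, Sm V f → EqOn (wD ρ w f) (wD ρ w' f) V := by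
  induction h with
  | nil => intro f _ x _; rfl
  | cons i _ ih => intro f hf; exact ih (hf.sD hV i)
  | swap i j l => intro f hf; exact wD_congr hV l (sD_comm hV hf i j)
  | trans _ _ ih1 ih2 => intro f hf; exact (ih1 hf).trans (ih2 hf)

lemma wD_const_mul (w : List (Fin m)) (c : ℝ) (f : (Fin m → ℝ) → ℝ) :
    wD ρ w (fun y => c * f y) = fun y => c * wD ρ w f y := by
  induction w generalizing f with
  | nil => rfl
  | cons i w ih =>
    simp only [wD]
    rw [← ih]
    congr 1
    funext y
    simp only [sD, pDeriv_const_mul]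
    ring

lemma wD_weight (w : List (Fin m)) (f : (Fin m → ℝ) → ℝ) :
    wD ρ w f = fun y => (w.map ρ).prod * wD (fun _ => 1) w f y := by
  induction w generalizing f with
  | nil => simp [wD]
  | cons i w ih =>
    simp only [wD, List.map_cons, List.prod_cons]
    rw [ih]
    have : sD ρ i f = fun y => ρ i * sD (fun _ => 1) i f y := by
      funext y; simp [sD]
    rw [this, wD_const_mul]
    funext y; ring

lemma wD_append (w w' : List (Fin m)) (f : (Fin m → ℝ) → ℝ) :
    wD ρ (w ++ w') f = wD ρ w' (wD ρ w f) := by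
  induction w generalizing f with
  | nil => rfl
  | cons i w ih => simp only [List.cons_append, wD, ih]

lemma wD_replicate (k : ℕ) (i : Fin m) (f : (Fin m → ℝ) → ℝ) :
    wD (fun _ => 1) (List.replicate k i) f = (pDeriv i)^[k] f := by
  induction k generalizing f with
  | zero => rfl
  | succ k ih =>
    simp only [List.replicate_succ, wD, Function.iterate_succ, Function.comp]
    rw [ih]
    congr 1
    funext y; simp [sD]

lemma mDeriv_eq_wD (ν : Fin m → ℕ) (f : (Fin m → ℝ) → ℝ) :
    ∃ w : List (Fin m), w.length = ∑ i, ν i ∧ mDeriv ν f = wD (fun _ => 1) w f := by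
  have key : ∀ l : List (Fin m), ∃ w : List (Fin m), w.length = (l.map ν).sum ∧
      l.foldr (fun i g => (pDeriv i)^[ν i] g) f = wD (fun _ => 1) w f := by
    intro l
    induction l with
    | nil => exact ⟨[], rfl, rfl⟩
    | cons i l ih =>
      obtain ⟨w, h1, h2⟩ := ih
      refine ⟨w ++ List.replicate (ν i) i, by simp [h1, add_comm], ?_⟩
      rw [List.foldr_cons, h2, wD_append, wD_replicate]
  obtain ⟨w, h1, h2⟩ := key (List.finRange m)
  refine ⟨w, ?_, h2⟩
  rw [h1, ← List.ofFn_eq_map, List.sum_ofFn]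

end perm

section analytic
variable {N : ℕ} {W : Set (Fin N → ℝ)} {Φ : (Fin N → ℝ) → ℝ}

/-- Iterated partial derivative, outermost letter first. -/
noncomputable def oD {N : ℕ} (β : List (Fin N)) (Φ : (Fin N → ℝ) → ℝ) : (Fin N → ℝ) → ℝ :=
  β.foldr (fun k g => pDeriv k g) Φ

lemma oD_smooth (hW : IsOpen W) (hΦ : Sm W Φ) (β : List (Fin N)) : Sm W (oD β Φ) := by
  induction β with
  | nil => exact hΦ
  | cons k β ih => exact Sm.pDeriv hW k ih

lemma oD_eq (hW : IsOpen W) (hΦ : Sm W Φ) (β : List (Fin N)) :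
    ∃ v : Fin β.length → (Fin N → ℝ), (∀ i, ‖v i‖ ≤ 1) ∧
      ∀ y ∈ W, oD β Φ y = iteratedFDeriv ℝ β.length Φ y v := by
  induction β with
  | nil => exact ⟨fun _ => 0, by simp, by intro y _; simp [oD]⟩
  | cons k β ih =>
    obtain ⟨v, hv, h⟩ := ih
    refine ⟨Fin.cons (Pi.single k 1) v, ?_, ?_⟩
    · intro i
      refine Fin.cases ?_ ?_ i
      · simp only [Fin.cons_zero]
        refine (pi_norm_le_iff_of_nonneg zero_le_one).2 fun l => ?_
        rw [Pi.single_apply]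
        split_ifs <;> simp
      · intro i; simpa using hv i
    · intro y hy
      have h1 : oD (k :: β) Φ y = pDeriv k (fun y => iteratedFDeriv ℝ β.length Φ y v) y :=
        pDeriv_congr hW k h hy
      have hc : ContDiffAt ℝ (⊤ : ℕ∞) Φ y := hΦ.contDiffAt (hW.mem_nhds hy)
      have hd : DifferentiableAt ℝ (iteratedFDeriv ℝ β.length Φ) y :=
        hc.differentiableAt_iteratedFDeriv (by exact_mod_cast ENat.natCast_lt_top _)
      rw [h1, pDeriv]
      change _ = iteratedFDeriv ℝ (β.length + 1) Φ y (Fin.cons (Pi.single k 1) v)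
      rw [iteratedFDeriv_succ_apply_left]
      rw [fderiv_continuousMultilinear_apply_const_apply hd]
      simp

lemma analytic_local (hΦ : AnalyticOnNhd ℝ Φ W) {y : Fin N → ℝ} (hy : y ∈ W) :
    ∃ t ∈ nhds y, ∃ C R : ℝ, 0 ≤ C ∧ 0 ≤ R ∧ ∀ z ∈ t, ∀ (q : ℕ) (v : Fin q → (Fin N → ℝ)),
      (∀ i, ‖v i‖ ≤ 1) → |iteratedFDeriv ℝ q Φ z v| ≤ C * R ^ q * q.factorial := by
  obtain ⟨p, r, hp⟩ := hΦ y hy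
  obtain ⟨r0, h0, h0r⟩ := ENNReal.lt_iff_exists_nnreal_btwn.mp hp.r_pos
  have h0' : 0 < r0 := by exact_mod_cast h0
  set s : NNReal := r0 / 2 with hs
  have hs0 : 0 < s := by positivity
  have hss : (s + s : ENNReal) < p.radius := by
    refine lt_of_lt_of_le ?_ hp.r_le
    have : (s + s : ENNReal) = r0 := by
      rw [← ENNReal.coe_add, hs, add_halves]
    rwa [this]
  have hsum := p.changeOriginSeries_summable_aux₁ hss
  set S := ∑' a : Σ k l : ℕ, { s : Finset (Fin (k + l)) // s.card = l },
      ‖p (a.1 + a.2.1)‖₊ * s ^ a.2.1 * s ^ a.1 with hS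
  refine ⟨Metric.ball y s, Metric.ball_mem_nhds _ (by exact_mod_cast hs0), S, (s : ℝ)⁻¹,
    by positivity, by positivity, ?_⟩
  intro z hz q v hv
  set u := z - y with hu
  have hun : ‖u‖₊ ≤ s := by
    have : ‖u‖ < s := by simpa [hu, dist_eq_norm] using hz
    exact_mod_cast this.le
  have hus : (‖u‖₊ : ENNReal) ≤ s := by exact_mod_cast hun
  have hur : (‖u‖₊ : ENNReal) < r := by
    refine lt_of_le_of_lt hus (lt_of_le_of_lt ?_ h0r)
    rw [hs]; exact_mod_cast half_le_self h0'.le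
  have hco := hp.changeOrigin hur
  have hzy : y + u = z := by simp [hu]
  rw [hzy] at hco
  rw [hco.iteratedFDeriv_eq_sum_of_completeSpace]
  have hb : ‖p.changeOrigin u q‖₊ * s ^ q ≤ S := by
    have h1 := p.nnnorm_changeOrigin_le q (x := u) (lt_of_lt_of_le hur hp.r_le)
    have h2 : Summable fun a : Σ l : ℕ, { s : Finset (Fin (q + l)) // s.card = l } =>
      ‖p (q + a.1)‖₊ * s ^ a.1 := p.changeOriginSeries_summable_aux₂
        (lt_of_le_of_lt le_self_add hss) q
    have h3 : ‖p.changeOrigin u q‖₊ ≤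
        ∑' a : Σ l : ℕ, { s : Finset (Fin (q + l)) // s.card = l },
          ‖p (q + a.1)‖₊ * s ^ a.1 := by
      refine h1.trans ?_
      refine Summable.tsum_le_tsum (fun a => by gcongr)
        (p.changeOriginSeries_summable_aux₂ (lt_of_lt_of_le hur hp.r_le) q) h2
    calc ‖p.changeOrigin u q‖₊ * s ^ q ≤ (∑' a : Σ l : ℕ, { s : Finset (Fin (q + l)) // s.card = l },
          ‖p (q + a.1)‖₊ * s ^ a.1) * s ^ q := by gcongr
      _ = ∑' a : Σ l : ℕ, { s : Finset (Fin (q + l)) // s.card = l },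
          ‖p (q + a.1)‖₊ * s ^ a.1 * s ^ q := by rw [NNReal.tsum_mul_right]
      _ ≤ S := by
        have h4 := NNReal.summable_sigma.1 hsum
        rw [hS, Summable.tsum_sigma' h4.1 hsum]
        exact h4.2.le_tsum q (fun _ _ => zero_le)
  have hb' : ‖p.changeOrigin u q‖ ≤ S * (s : ℝ)⁻¹ ^ q := by
    have : ‖p.changeOrigin u q‖ * (s : ℝ) ^ q ≤ S := by exact_mod_cast hb
    rw [inv_pow, ← div_eq_mul_inv, le_div_iff₀ (by positivity)]
    exact this
  calc |∑ σ : Equiv.Perm (Fin q), p.changeOrigin u q fun i => v (σ i)|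
      ≤ ∑ σ : Equiv.Perm (Fin q), |p.changeOrigin u q fun i => v (σ i)| :=
        Finset.abs_sum_le_sum_abs _ _
    _ ≤ ∑ σ : Equiv.Perm (Fin q), S * (s : ℝ)⁻¹ ^ q := by
        refine Finset.sum_le_sum fun σ _ => ?_
        have h5 := (p.changeOrigin u q).le_opNorm (fun i => v (σ i))
        rw [← Real.norm_eq_abs]
        refine h5.trans (le_trans ?_ hb')
        exact mul_le_of_le_one_right (norm_nonneg _)
          (Finset.prod_le_one (fun _ _ => norm_nonneg _) (fun i _ => hv _))
    _ = S * (s : ℝ)⁻¹ ^ q * q.factorial := by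
        simp [Finset.card_univ, Fintype.card_perm]; ring

lemma analytic_bound (hW : IsOpen W) (hΦ : AnalyticOnNhd ℝ Φ W) {K : Set (Fin N → ℝ)}
    (hK : IsCompact K) (hKW : K ⊆ W) :
    ∃ C R : ℝ, 0 ≤ C ∧ 0 ≤ R ∧ ∀ y ∈ K, ∀ β : List (Fin N),
      |oD β Φ y| ≤ C * R ^ β.length * β.length.factorial := by
  have key : ∃ C R : ℝ, 0 ≤ C ∧ 0 ≤ R ∧ ∀ z ∈ K, ∀ (q : ℕ) (v : Fin q → (Fin N → ℝ)),
      (∀ i, ‖v i‖ ≤ 1) → |iteratedFDeriv ℝ q Φ z v| ≤ C * R ^ q * q.factorial := by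
    refine hK.induction_on (p := fun K => ∃ C R : ℝ, 0 ≤ C ∧ 0 ≤ R ∧ ∀ z ∈ K, ∀ (q : ℕ)
      (v : Fin q → (Fin N → ℝ)),
      (∀ i, ‖v i‖ ≤ 1) → |iteratedFDeriv ℝ q Φ z v| ≤ C * R ^ q * q.factorial) ?_ ?_ ?_ ?_
    · exact ⟨0, 0, le_rfl, le_rfl, by simp⟩
    · rintro s t hst ⟨C, R, hC, hR, h⟩
      exact ⟨C, R, hC, hR, fun z hz => h z (hst hz)⟩
    · rintro s t ⟨C, R, hC, hR, h⟩ ⟨C', R', hC', hR', h'⟩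
      refine ⟨max C C', max R R', le_max_of_le_left hC, le_max_of_le_left hR, ?_⟩
      rintro z (hz | hz) q v hv
      · refine (h z hz q v hv).trans ?_
        gcongr
        · exact le_max_left _ _
        · exact le_max_left _ _
      · refine (h' z hz q v hv).trans ?_
        gcongr
        · exact le_max_right _ _
        · exact le_max_right _ _
    · intro y hy
      obtain ⟨t, ht, h⟩ := analytic_local hΦ (hKW hy)
      exact ⟨t, mem_nhdsWithin_of_mem_nhds ht, h⟩
  obtain ⟨C, R, hC, hR, h⟩ := key
  refine ⟨C, R, hC, hR, fun y hy β => ?_⟩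
  obtain ⟨v, hv, e⟩ := oD_eq hW hΦ.contDiffOn_of_completeSpace β
  rw [e y (hKW hy)]
  exact h y hy _ v hv

end analytic

section monomial
variable {m : ℕ} {V : Set (Fin m → ℝ)}

lemma pDeriv_rpow {y : Fin m → ℝ} (i j : Fin m) (hy : 0 < y i) (c a : ℝ) :
    pDeriv j (fun y : Fin m → ℝ => c * y i ^ (-a)) y =
      if j = i then c * (-a) * y i ^ (-(a + 1)) else 0 := by
  have h1 : HasFDerivAt (fun y : Fin m → ℝ => y i) (ContinuousLinearMap.proj i : (Fin m → ℝ) →L[ℝ] ℝ) y :=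
    hasFDerivAt_apply i y
  have h2 := (h1.rpow_const (p := -a) (Or.inl hy.ne')).const_mul c
  rw [pDeriv, h2.fderiv]
  have e : -a - 1 = -(a + 1) := by ring
  by_cases hij : j = i
  · subst hij
    simp [e]; ring
  · have : i ≠ j := fun h => hij h.symm
    simp [hij, this]

lemma rpow_bound (hV : IsOpen V) (hpos : ∀ y ∈ V, ∀ i, 0 < y i) {x : Fin m → ℝ} (hx : x ∈ V)
    (i : Fin m) (w : List (Fin m)) (c a : ℝ) (ha : 0 ≤ a) :
    |wD x w (fun y => c * y i ^ (-a)) x| ≤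
      |c| * x i ^ (-a) * ∏ l ∈ Finset.range w.length, (a + l) := by
  have hxi := hpos x hx i
  induction w generalizing c a with
  | nil => simp [wD, abs_mul, abs_of_pos (Real.rpow_pos_of_pos hxi _)]
  | cons j w ih =>
    simp only [wD, List.length_cons]
    have hP : 0 ≤ ∏ l ∈ Finset.range (w.length + 1), (a + l) :=
      Finset.prod_nonneg fun l _ => by positivity
    by_cases hij : j = i
    · have h1 : EqOn (sD x j (fun y => c * y i ^ (-a)))
          (fun y => (x i * c * (-a)) * y i ^ (-(a + 1))) V := by
        intro y hy
        simp only [sD]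
        rw [pDeriv_rpow i j (hpos y hy i), if_pos hij, hij]
        ring
      rw [wD_congr hV w h1 hx]
      refine (ih _ _ (by linarith)).trans (le_of_eq ?_)
      rw [Finset.prod_range_succ', abs_mul, abs_mul, abs_neg, abs_of_pos hxi, abs_of_nonneg ha,
        neg_add, Real.rpow_add hxi, Real.rpow_neg_one]
      have : ∀ l : ℕ, a + 1 + (l : ℝ) = a + ((l + 1 : ℕ) : ℝ) := by intro l; push_cast; ring
      simp only [this]
      field_simp
      simp
    · have h1 : EqOn (sD x j (fun y => c * y i ^ (-a))) (fun _ => 0) V := by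
        intro y hy
        simp only [sD, pDeriv_rpow i j (hpos y hy i), hij, if_false, mul_zero]
      rw [wD_congr hV w h1 hx, wD_zero]
      simp only [abs_zero]
      positivity

/-- The exponent of a monomial composed with the power substitution. -/
noncomputable def gfun (α : ℝ) (μ : Fin m → ℝ) (y : Fin m → ℝ) : ℝ :=
  ∑ i, μ i * (1 - y i ^ (-α))

variable {α : ℝ} {μ : Fin m → ℝ}

lemma gfun_smooth (hpos : ∀ y ∈ V, ∀ i, 0 < y i) : Sm V (gfun α μ) := by
  refine Sm.sum fun i _ => ?_
  refine ContDiffOn.mul contDiffOn_const (ContDiffOn.sub contDiffOn_const ?_)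
  exact ContDiffOn.rpow_const_of_ne (contDiff_apply ℝ ℝ i).contDiffOn
    (fun y hy => (hpos y hy i).ne')

lemma gfun_sD (hpos : ∀ y ∈ V, ∀ i, 0 < y i) (ρ : Fin m → ℝ) (i : Fin m) :
    EqOn (sD ρ i (gfun α μ)) (fun y => (ρ i * μ i * α) * y i ^ (-(α + 1))) V := by
  intro y hy
  have h : ∀ j, HasFDerivAt (fun y : Fin m → ℝ => μ j * (1 - y j ^ (-α)))
      (μ j • -(((-α) * y j ^ (-α - 1)) • (ContinuousLinearMap.proj j : (Fin m → ℝ) →L[ℝ] ℝ))) y := by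
    intro j
    have h1 : HasFDerivAt (fun y : Fin m → ℝ => y j)
      (ContinuousLinearMap.proj j : (Fin m → ℝ) →L[ℝ] ℝ) y := hasFDerivAt_apply j y
    exact ((h1.rpow_const (p := -α) (Or.inl (hpos y hy j).ne')).const_sub 1).const_mul _
  have h2 := HasFDerivAt.fun_sum (u := Finset.univ) fun j _ => h j
  have h3 : fderiv ℝ (gfun α μ) y = _ := h2.fderiv
  have e : -α - 1 = -(α + 1) := by ring
  simp only [sD, pDeriv, h3]
  rw [_root_.sum_apply, Finset.sum_eq_single i]
  · simp [e]; ring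
  · intro j _ hj
    simp [Pi.single_apply, hj]
  · simp

lemma sD_exp (hV : IsOpen V) {ρ : Fin m → ℝ} {g : (Fin m → ℝ) → ℝ} (hg : Sm V g) (i : Fin m) :
    EqOn (sD ρ i (fun y => Real.exp (g y))) (fun y => Real.exp (g y) * sD ρ i g y) V := by
  intro y hy
  have := (hg.diffAt hV hy).hasFDerivAt.exp
  simp only [sD, pDeriv, this.fderiv]
  simp; ring

lemma prod_fact (a : ℝ) (ha : 0 ≤ a) (n : ℕ) :
    ∏ l ∈ Finset.range n, (a + l) ≤ (a + 1) ^ n * n.factorial := by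
  induction n with
  | zero => simp
  | succ n ih =>
    rw [Finset.prod_range_succ, Nat.factorial_succ, pow_succ]
    have : a + n ≤ (a + 1) * (n + 1) := by nlinarith [mul_nonneg ha (Nat.cast_nonneg (α := ℝ) n)]
    calc _ ≤ ((a + 1) ^ n * n.factorial) * ((a + 1) * (n + 1)) := by gcongr
      _ = _ := by push_cast; ring

lemma gfun_bound (hα : 0 < α) (hV : IsOpen V) (hpos : ∀ y ∈ V, ∀ i, 0 < y i) {x : Fin m → ℝ}
    (hx : x ∈ V) {T : ℝ} (hT : ∀ i, μ i ≠ 0 → x i ^ (-α) ≤ T) (hT0 : 0 ≤ T)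
    (i : Fin m) (w : List (Fin m)) :
    |wD x w (sD x i (gfun α μ)) x| ≤
      ((∑ i, |μ i|) * T) * (α + 1) ^ (w.length + 1) * (w.length + 1).factorial := by
  have hxi := hpos x hx i
  rw [wD_congr hV w (gfun_sD hpos x i) hx]
  refine (rpow_bound hV hpos hx i w _ _ (by linarith)).trans ?_
  have h1 := prod_fact α hα.le (w.length + 1)
  rw [Finset.prod_range_succ'] at h1
  have h2 : ∀ l : ℕ, α + 1 + (l : ℝ) = α + ((l + 1 : ℕ) : ℝ) := by intro l; push_cast; ring
  simp only [h2]
  set Pr := ∏ l ∈ Finset.range w.length, (α + ((l + 1 : ℕ) : ℝ))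
  have h3 : |μ i| * x i ^ (-α) ≤ (∑ i, |μ i|) * T := by
    by_cases h0 : μ i = 0
    · rw [h0]; simp; positivity
    · have := hT i h0
      have h4 : |μ i| ≤ ∑ i, |μ i| :=
        Finset.single_le_sum (f := fun i => |μ i|) (fun _ _ => abs_nonneg _) (Finset.mem_univ i)
      gcongr
  calc |x i * μ i * α| * x i ^ (-(α + 1)) * Pr
      = (|μ i| * x i ^ (-α)) * (Pr * (α + ((0 : ℕ) : ℝ))) := by
        rw [abs_mul, abs_mul, abs_of_pos hxi, abs_of_pos hα, neg_add, Real.rpow_add hxi,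
          Real.rpow_neg_one]
        field_simp
        simp
        ring
    _ ≤ ((∑ i, |μ i|) * T) * ((α + 1) ^ (w.length + 1) * (w.length + 1).factorial) := by
        gcongr
    _ = _ := by ring

lemma exp_bound (hα : 0 < α) (hV : IsOpen V) (hpos : ∀ y ∈ V, ∀ i, 0 < y i) {x : Fin m → ℝ}
    (hx : x ∈ V) {T : ℝ} (hT : ∀ i, μ i ≠ 0 → x i ^ (-α) ≤ T) (hT0 : 0 < T)
    (i : Fin m) (w : List (Fin m)) :
    |wD x w (sD x i (fun y => Real.exp (gfun α μ y))) x| ≤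
      Real.exp (gfun α μ x + T / 2) * (4 * (α + 1) * (1 + 2 * ∑ i, |μ i|)) ^ (w.length + 1) *
        (w.length + 1).factorial := by
  have hg : Sm V (gfun α μ) := gfun_smooth hpos
  have := comp_bound (N := 1) (H := fun _ y => Real.exp (gfun α μ y)) (c := fun _ => gfun α μ)
    (C := Real.exp (gfun α μ x + T / 2)) (R := 2 / T) (M := (∑ i, |μ i|) * T) (K := α + 1)
    (A := 4 * (α + 1) * (1 + 2 * ∑ i, |μ i|)) (ρ := x)
    hV hx (fun _ => ContDiffOn.exp hg) (fun _ => hg)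
    (fun _ i => by simpa using sD_exp hV hg i) (by positivity) (by positivity) (by positivity)
    (by positivity) (by field_simp; simp)
    (by
      intro β
      have h1 := Real.pow_div_factorial_le_exp (T / 2) (by positivity) β.length
      rw [abs_of_pos (Real.exp_pos _), Real.exp_add]
      rw [div_le_iff₀ (by positivity)] at h1
      have h2 : (2 / T) ^ β.length * (T / 2) ^ β.length = 1 := by
        rw [← mul_pow]; field_simp; simp
      calc Real.exp (gfun α μ x) = Real.exp (gfun α μ x) *
            ((2 / T) ^ β.length * (T / 2) ^ β.length) := by rw [h2, mul_one]
        _ ≤ Real.exp (gfun α μ x) *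
            ((2 / T) ^ β.length * (Real.exp (T / 2) * β.length.factorial)) := by gcongr
        _ = _ := by ring)
    (fun _ i w => gfun_bound hα hV hpos hx hT hT0.le i w) (w.length + 1) (i :: w) (by simp) []
  simpa [wD] using this

lemma mono_pDeriv {μ : Fin m → ℝ} {y : Fin m → ℝ} (hy : ∀ i, 0 < y i) (i : Fin m) :
    pDeriv i (fun y : Fin m → ℝ => ∏ j, y j ^ μ j) y = (∏ j, y j ^ μ j) * (μ i / y i) := by
  have h1 : ∀ j, HasFDerivAt (fun y : Fin m → ℝ => y j ^ μ j)
      ((μ j * y j ^ (μ j - 1)) • (ContinuousLinearMap.proj j : (Fin m → ℝ) →L[ℝ] ℝ)) y := by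
    intro j
    exact (hasFDerivAt_apply j y).rpow_const (Or.inl (hy j).ne')
  have h2 := HasFDerivAt.finsetProd (u := Finset.univ) fun j _ => h1 j
  rw [pDeriv]
  rw [h2.fderiv, _root_.sum_apply, Finset.sum_eq_single i]
  · rw [← Finset.mul_prod_erase Finset.univ (fun j => y j ^ μ j) (Finset.mem_univ i)]
    simp [Real.rpow_sub (hy i)]; ring
  · intro j _ hj
    simp [Pi.single_apply, hj]
  · simp

end monomial

section final
variable {m : ℕ} {V : Set (Fin m → ℝ)}

lemma single_bound {α : ℝ} (hα : 0 < α) (hV : IsOpen V) (hpos : ∀ y ∈ V, ∀ i, 0 < y i)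
    (μ : Fin m → ℝ) (L : ℝ) (hL0 : 0 ≤ L)
    (hL : ∀ y ∈ V, ∀ i, μ i ≠ 0 → Real.exp (gfun α μ y) ≤ L * Real.exp (-(y i ^ (-α))))
    {x : Fin m → ℝ} (hx : x ∈ V) (i : Fin m) (w : List (Fin m)) :
    |wD x w (sD x i (fun y => Real.exp (gfun α μ y))) x| ≤
      (L * Real.exp (-(x i ^ (-α)) / 2)) *
        (4 * (α + 1) * (1 + 2 * ∑ i, |μ i|)) ^ (w.length + 1) * (w.length + 1).factorial := by
  by_cases hi : μ i = 0
  · have h1 : EqOn (sD x i (fun y => Real.exp (gfun α μ y))) (fun _ => 0) V := by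
      intro y hy
      rw [sD_exp hV (gfun_smooth hpos) i hy]
      simp only
      rw [gfun_sD hpos x i hy]
      simp [hi]
    rw [wD_congr hV w h1 hx, wD_zero]
    simp only [abs_zero]
    positivity
  · obtain ⟨k, hk, hmax⟩ := Finset.exists_max_image (Finset.univ.filter fun i => μ i ≠ 0)
      (fun i => x i ^ (-α)) ⟨i, by simp [hi]⟩
    simp only [Finset.mem_filter, Finset.mem_univ, true_and] at hk hmax
    have h1 := exp_bound hα hV hpos hx hmax (Real.rpow_pos_of_pos (hpos x hx k) _) i w
    refine h1.trans ?_
    gcongr ?_ * _ * _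
    rw [Real.exp_add]
    set T := x k ^ (-α)
    calc Real.exp (gfun α μ x) * Real.exp (T / 2)
        ≤ (L * Real.exp (-T)) * Real.exp (T / 2) := by
          gcongr; exact hL x hx k hk
      _ = L * Real.exp (-T / 2) := by
          rw [mul_assoc, ← Real.exp_add]; congr 2; ring
      _ ≤ L * Real.exp (-(x i ^ (-α)) / 2) := by
          have := hmax i hi
          gcongr

lemma chain {N : ℕ} {W : Set (Fin N → ℝ)} {Ψ : (Fin N → ℝ) → ℝ} (hV : IsOpen V) (hW : IsOpen W)
    (hΨ : Sm W Ψ) (c : (Fin m → ℝ) → Fin N → ℝ) (hc : ∀ k, Sm V (fun y => c y k))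
    (hcW : ∀ y ∈ V, c y ∈ W) (ρ : Fin m → ℝ) (i : Fin m) :
    EqOn (sD ρ i (fun y => Ψ (c y)))
      (fun y => ∑ k, pDeriv k Ψ (c y) * sD ρ i (fun y => c y k) y) V := by
  intro y hy
  have h1 : HasFDerivAt c (ContinuousLinearMap.pi fun k => fderiv ℝ (fun y => c y k) y) y :=
    hasFDerivAt_pi.2 fun k => ((hc k).diffAt hV hy).hasFDerivAt
  have h2 := (hΨ.diffAt hW (hcW y hy)).hasFDerivAt
  have h3 : HasFDerivAt (fun y => Ψ (c y)) _ y := h2.comp y h1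
  simp only [sD, pDeriv, h3.fderiv]
  rw [ContinuousLinearMap.comp_apply]
  set v := (ContinuousLinearMap.pi fun k => fderiv ℝ (fun y => c y k) y) (Pi.single i (1 : ℝ))
  have h4 : fderiv ℝ Ψ (c y) v = ∑ k, v k * fderiv ℝ Ψ (c y) (Pi.single k 1) := by
    have := LinearMap.pi_apply_eq_sum_univ (fderiv ℝ Ψ (c y) : (Fin N → ℝ) →ₗ[ℝ] ℝ) v
    simp only [smul_eq_mul, ContinuousLinearMap.coe_coe] at this
    rw [this]
    refine Finset.sum_congr rfl fun k _ => ?_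
    congr 2
    funext l
    simp [Pi.single_apply, eq_comm]
  rw [h4, Finset.mul_sum]
  refine Finset.sum_congr rfl fun k _ => ?_
  have : v k = fderiv ℝ (fun y => c y k) y (Pi.single i 1) := rfl
  rw [this]; ring

lemma decay {α t : ℝ} (hα : 0 < α) (ht : 0 < t) (n : ℕ) :
    Real.exp (-(t ^ (-α)) / 2) ≤ t ^ n * (((2 / α) ^ (1 / α)) ^ n * (n.factorial : ℝ) ^ (1 / α)) := by
  set u := t ^ (-α) with hu
  have hu0 : 0 < u := Real.rpow_pos_of_pos ht _
  have h1 := Real.pow_div_factorial_le_exp (α * u / 2) (by positivity) n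
  rw [div_le_iff₀ (by positivity)] at h1
  have h2 : u ^ n ≤ (2 / α) ^ n * n.factorial * Real.exp (α * u / 2) := by
    have : u ^ n = (2 / α) ^ n * (α * u / 2) ^ n := by
      rw [← mul_pow]; congr 1; field_simp
    rw [this, mul_assoc]
    gcongr
    linarith
  have h3 := Real.rpow_le_rpow (by positivity) h2 (by positivity : 0 ≤ 1 / α)
  rw [Real.mul_rpow (by positivity) (by positivity), Real.mul_rpow (by positivity) (by positivity),
    ← Real.exp_mul] at h3
  have e1 : (u ^ n) ^ (1 / α) = (t ^ n)⁻¹ := by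
    rw [hu, ← Real.rpow_natCast, ← Real.rpow_mul ht.le, ← Real.rpow_mul ht.le,
      ← Real.rpow_natCast, ← Real.rpow_neg ht.le]
    congr 1; field_simp
  have e2 : ((2 / α) ^ n : ℝ) ^ (1 / α) = ((2 / α) ^ (1 / α)) ^ n := by
    rw [← Real.rpow_natCast, ← Real.rpow_natCast, ← Real.rpow_mul (by positivity),
      ← Real.rpow_mul (by positivity), mul_comm]
  have e3 : α * u / 2 * (1 / α) = u / 2 := by field_simp
  rw [e1, e2, e3] at h3
  have e4 : Real.exp (-u / 2) = (Real.exp (u / 2))⁻¹ := by rw [← Real.exp_neg]; congr 1; ring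
  rw [e4, inv_le_iff_one_le_mul₀ (Real.exp_pos _)]
  have h5 := mul_le_mul_of_nonneg_left h3 (by positivity : 0 ≤ t ^ n)
  rw [mul_inv_cancel₀ (by positivity)] at h5
  linarith

lemma list_prod_ge {x : Fin m → ℝ} {t : ℝ} (ht : 0 ≤ t) (l : List (Fin m))
    (h : ∀ i ∈ l, t ≤ x i) : t ^ l.length ≤ (l.map x).prod := by
  induction l with
  | nil => simp
  | cons i l ih =>
    simp only [List.length_cons, List.map_cons, List.prod_cons, pow_succ']
    have h1 := h i (by simp)
    have h2 := ih fun j hj => h j (by simp [hj])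
    gcongr
    exact ht.trans h1

end final

theorem stmt18 {m n : ℕ} (α : ℝ) (hα : 0 < α)
    (U : Set (Fin m → ℝ)) (hUo : IsOpen U)
    (hU : U ⊆ univ.pi fun _ : Fin m => Ioo (0:ℝ) 1)
    (b : (Fin m → ℝ) → Fin n → ℝ)
    -- `b` is a bounded-monomial map: each component is identically zero on `U`
    -- or a power map `x ^ μ` on `U`, with bounded image
    (hbm : ∀ i : Fin n, (∀ x ∈ U, b x i = 0) ∨
      ∃ μ : Fin m → ℝ, ∀ x ∈ U, b x i = ∏ j, x j ^ μ j)
    (hbdd : ∀ i : Fin n, ∃ M : ℝ, ∀ x ∈ U, |b x i| ≤ M)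
    -- all first-order partial derivatives of all components of `b` are bounded on `U`
    (hpart : ∀ i : Fin n, ∀ j : Fin m, ∃ M : ℝ, ∀ x ∈ U, |pDeriv j (fun x => b x i) x| ≤ M)
    -- `F` is a unit on the image of `b`: analytic and non-vanishing on an open
    -- neighborhood of the closure of the image of `b`
    (F : (Fin n → ℝ) → ℝ) (W : Set (Fin n → ℝ)) (hWo : IsOpen W)
    (hW : closure (b '' U) ⊆ W) (hF : AnalyticOnNhd ℝ F W) (hF0 : ∀ y ∈ W, F y ≠ 0)
    (j : Fin n) (f : (Fin m → ℝ) → ℝ) (hf : ∀ x ∈ U, f x = b x j * F (b x))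
    (P : (Fin m → ℝ) → Fin m → ℝ) (hP : ∀ x i, P x i = exp (1 - x i ^ (-α))) :
    ∃ A B : ℝ, 0 < A ∧ 0 < B ∧
      IsMildM ((univ.pi fun _ : Fin m => Ioo (0:ℝ) 1) ∩ P ⁻¹' U) (f ∘ P) A B (1 / α) := by

  classical
  set V : Set (Fin m → ℝ) := (univ.pi fun _ : Fin m => Ioo (0:ℝ) 1) ∩ P ⁻¹' U with hVdef
  have hcube : IsOpen (univ.pi fun _ : Fin m => Ioo (0:ℝ) 1) :=
    isOpen_set_pi finite_univ fun _ _ => isOpen_Ioo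
  have hPc : ContinuousOn P (univ.pi fun _ : Fin m => Ioo (0:ℝ) 1) := by
    refine continuousOn_pi.2 fun i => ?_
    simp only [hP]
    refine Real.continuous_exp.comp_continuousOn (continuousOn_const.sub ?_)
    exact ContinuousOn.rpow_const (continuous_apply i).continuousOn
      fun y hy => Or.inl (hy i (mem_univ i)).1.ne'
  have hV : IsOpen V := hPc.isOpen_inter_preimage hcube hUo
  have hpos : ∀ y ∈ V, ∀ i, 0 < y i := fun y hy i => (hy.1 i (mem_univ i)).1
  have hVU : ∀ y ∈ V, P y ∈ U := fun y hy => hy.2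
  -- the monomials after substitution
  have hmono : ∀ k μ, (∀ x ∈ U, b x k = ∏ j, x j ^ μ j) →
      EqOn (fun y => b (P y) k) (fun y => Real.exp (gfun α μ y)) V := by
    intro k μ h y hy
    simp only [h _ (hVU y hy), gfun, Real.exp_sum]
    refine Finset.prod_congr rfl fun i _ => ?_
    rw [hP, ← Real.exp_mul, mul_comm]
  have hcs : ∀ k, Sm V (fun y => b (P y) k) := by
    intro k
    rcases hbm k with h | ⟨μ, h⟩
    · exact Sm.congr (f := fun _ => 0) contDiffOn_const fun y hy => h _ (hVU y hy)
    · exact Sm.congr (ContDiffOn.exp (gfun_smooth hpos)) (hmono k μ h)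
  have hcb : ∀ k, ∃ M K : ℝ, 0 ≤ M ∧ 0 ≤ K ∧ ∀ x ∈ V, ∀ i, ∀ w : List (Fin m),
      |wD x w (sD x i (fun y => b (P y) k)) x| ≤
        (M * Real.exp (-(x i ^ (-α)) / 2)) * K ^ (w.length + 1) * (w.length + 1).factorial := by
    intro k
    rcases hbm k with h | ⟨μ, h⟩
    · refine ⟨0, 0, le_rfl, le_rfl, fun x hx i w => ?_⟩
      have h1 : EqOn (fun y => b (P y) k) (fun _ => 0) V := fun y hy => h _ (hVU y hy)
      rw [wD_congr hV w (sD_congr hV i h1) hx, sD_zero, wD_zero]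
      simp
    · choose Mb hMb using hpart k
      set L := ∑ i, |Mb i| / |μ i| * Real.exp 1 with hL
      have hL0 : 0 ≤ L := Finset.sum_nonneg fun i _ => by positivity
      refine ⟨L, 4 * (α + 1) * (1 + 2 * ∑ i, |μ i|), hL0, by positivity, fun x hx i w => ?_⟩
      rw [wD_congr hV w (sD_congr hV i (hmono k μ h)) hx]
      refine single_bound hα hV hpos μ L hL0 ?_ hx i w
      intro y hy i hi
      have h1 := hMb i (P y) (hVU y hy)
      have hPpos : ∀ i, 0 < P y i := fun i => by rw [hP]; exact Real.exp_pos _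
      rw [pDeriv_congr hUo i (g := fun x => ∏ j, x j ^ μ j) (fun x hx => h x hx) (hVU y hy),
        mono_pDeriv hPpos, ← h _ (hVU y hy)] at h1
      have h2 := hmono k μ h hy
      simp only at h2
      rw [h2, abs_mul, abs_div, abs_of_pos (Real.exp_pos _), abs_of_pos (hPpos i)] at h1
      have hi' : 0 < |μ i| := abs_pos.mpr hi
      have h3 : Real.exp (gfun α μ y) ≤ |Mb i| / |μ i| * P y i := by
        have h4 := h1.trans (le_abs_self _)
        rw [← mul_div_assoc, div_le_iff₀ (hPpos i)] at h4
        rw [div_mul_eq_mul_div, le_div_iff₀ hi']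
        exact h4
      rw [hP, sub_eq_add_neg, Real.exp_add, ← mul_assoc] at h3
      refine h3.trans ?_
      gcongr
      exact Finset.single_le_sum (f := fun i => |Mb i| / |μ i| * Real.exp 1)
        (fun i _ => by positivity) (Finset.mem_univ i)
  choose Mk Kk hMk hKk hck using hcb
  set M := ∑ k, Mk k with hM
  set K := ∑ k, Kk k with hK
  have hM0 : 0 ≤ M := Finset.sum_nonneg fun k _ => hMk k
  have hK0 : 0 ≤ K := Finset.sum_nonneg fun k _ => hKk k
  have hc' : ∀ x ∈ V, ∀ i k, ∀ w : List (Fin m),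
      |wD x w (sD x i (fun y => b (P y) k)) x| ≤
        (M * Real.exp (-(x i ^ (-α)) / 2)) * K ^ (w.length + 1) * (w.length + 1).factorial := by
    intro x hx i k w
    refine (hck k x hx i w).trans ?_
    have h1 : Mk k ≤ M := Finset.single_le_sum (fun k _ => hMk k) (Finset.mem_univ k)
    have h2 : Kk k ≤ K := Finset.single_le_sum (fun k _ => hKk k) (Finset.mem_univ k)
    have := hKk k
    gcongr
  -- the outer analytic function
  set Φ : (Fin n → ℝ) → ℝ := fun y => y j * F y with hΦdef
  have hΦ : AnalyticOnNhd ℝ Φ W := by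
    refine AnalyticOnNhd.mul ?_ hF
    intro y _
    exact (ContinuousLinearMap.proj j : (Fin n → ℝ) →L[ℝ] ℝ).analyticAt y
  have hΦs : Sm W Φ := hΦ.contDiffOn_of_completeSpace
  have hcomp : IsCompact (closure (b '' U)) := by
    choose Mb hMb using hbdd
    refine Bornology.IsBounded.isCompact_closure ?_
    refine (isCompact_univ_pi fun i => isCompact_Icc (a := -Mb i) (b := Mb i)).isBounded.subset ?_
    rintro _ ⟨x, hx, rfl⟩ i _
    exact abs_le.mp (hMb i x hx)
  obtain ⟨C, R, hC, hR, hCR⟩ := analytic_bound hWo hΦ hcomp hW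
  have hbcl : ∀ y ∈ V, b (P y) ∈ closure (b '' U) := fun y hy =>
    subset_closure ⟨P y, hVU y hy, rfl⟩
  have hbW : ∀ y ∈ V, b (P y) ∈ W := fun y hy => hW (hbcl y hy)
  set H : List (Fin n) → (Fin m → ℝ) → ℝ := fun β y => oD β Φ (b (P y)) with hH
  have hHs : ∀ β, Sm V (H β) := by
    intro β
    have h1 : ContDiffOn ℝ (⊤ : ℕ∞) (fun y => b (P y)) V := contDiffOn_pi.2 hcs
    exact (oD_smooth hWo hΦs β).comp h1 hbW
  have hHc : ∀ ρ : Fin m → ℝ, ∀ β i, EqOn (sD ρ i (H β))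
      (fun y => ∑ k, H (k :: β) y * sD ρ i (fun y => b (P y) k) y) V := fun ρ β i =>
    chain hV hWo (oD_smooth hWo hΦs β) (fun y => b (P y)) hcs hbW ρ i
  have hfH : EqOn (f ∘ P) (H []) V := fun y hy => hf _ (hVU y hy)
  set A := 4 * K * (1 + R * n * M) with hA
  have hA0 : 0 ≤ A := by positivity
  set D := (2 / α) ^ (1 / α) with hD
  have hD0 : 0 ≤ D := by positivity
  refine ⟨A * D + 1, C + R * n * M * C + 1, by positivity, by positivity,
    (hHs []).congr hfH, ?_⟩
  intro x hx ν
  obtain ⟨w, hw, hmd⟩ := mDeriv_eq_wD ν (f ∘ P)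
  rw [hmd, ← hw, wD_congr hV w hfH hx]
  have hb : ∀ β : List (Fin n), |H β x| ≤ C * R ^ β.length * β.length.factorial :=
    fun β => hCR _ (hbcl x hx) β
  by_cases hw0 : w = []
  · subst hw0
    have h1 := hb []
    simp only [List.length_nil, pow_zero, mul_one, Nat.factorial_zero, Nat.cast_one,
      Real.one_rpow, wD] at h1 ⊢
    have : 0 ≤ R * n * M * C := by positivity
    linarith
  obtain ⟨i, hi, hmin⟩ := Finset.exists_min_image w.toFinset x
    (List.toFinset_nonempty_iff w |>.mpr hw0)
  simp only [List.mem_toFinset] at hi hmin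
  have hxi := hpos x hx i
  have hperm := List.perm_cons_erase hi
  set w' := w.erase i
  have hlen : w.length = w'.length + 1 := by simpa using hperm.length_eq
  have key := comp_bound' (ρ := x) (M' := M * Real.exp (-(x i ^ (-α)) / 2)) hV hx hHs hcs
    (hHc x) hC hR hM0 (by positivity) hK0 hA hb
    (fun k i w => by
      refine (hc' x hx i k w).trans ?_
      gcongr
      refine mul_le_of_le_one_right hM0 (Real.exp_le_one_iff.mpr ?_)
      have := Real.rpow_pos_of_pos (hpos x hx i) (-α)
      linarith) i (fun k w => hc' x hx i k w) w'
  rw [← hlen] at key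
  have h1 : wD x w' (sD x i (H [])) x = (w.map x).prod * wD (fun _ => 1) w (H []) x := by
    have : wD x w' (sD x i (H [])) x = wD x (i :: w') (H []) x := rfl
    rw [this, ← wD_perm hV hperm (hHs []) hx, wD_weight]
  have h2 := list_prod_ge hxi.le w hmin
  have hxn : 0 < x i ^ w.length := by positivity
  rw [h1, abs_mul, abs_of_pos (hxn.trans_le h2)] at key
  set Y := |wD (fun _ => 1) w (H []) x|
  have h3 : x i ^ w.length * Y ≤ _ := (mul_le_mul_of_nonneg_right h2 (abs_nonneg _)).trans key
  have h4 := decay hα hxi w.length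
  set N := w.length
  have h5 : x i ^ N * Y ≤ x i ^ N *
      ((R * n * M * C) * (A * D) ^ N * ((N.factorial : ℝ) ^ (1 / α) * N.factorial)) := by
    refine h3.trans ?_
    calc R * n * (M * Real.exp (-(x i ^ (-α)) / 2)) * (C * A ^ N * N.factorial)
        ≤ R * n * (M * (x i ^ N * (D ^ N * (N.factorial : ℝ) ^ (1 / α)))) *
            (C * A ^ N * N.factorial) := by gcongr
      _ = _ := by rw [mul_pow A D]; ring
  have h6 := le_of_mul_le_mul_left h5 hxn
  refine h6.trans ?_
  rw [Real.rpow_add_one (by positivity)]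
  gcongr
  · linarith
  · linarith
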